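/- Let n ≥ 2 and let w = (a_1,…,a_k) and w' = (a'_1,…,a'_{k'}) be words with letters in {1,…,n−1}, with associated permutations π_t and π'_t and operators W_w(z,λ), W_{w'}(z,λ) on (ℂ^N)^{⊗n} as defined below. If the induced permutations coincide, π_k = π'_{k'} in S_n, then W_w(z,λ) = W_{w'}(z,λ) for all (z,λ,γ) in a dense open subset of ℂ^n × ℂ^N × ℂ (on which both products are defined). -/

import Mathlib

open scoped BigOperators
open Complex Matrix Filter Topology

noncomputable section

namespace EllipticQG

/-- Jacobi's first theta function `θ(z) = -∑_{j ∈ ℤ+1/2} e^{πij²τ + 2πij(z+1/2)}`. -/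
def theta (τ z : ℂ) : ℂ :=
  -∑' j : ℤ, Complex.exp ((Real.pi : ℂ) * Complex.I * ((j : ℂ) + 1 / 2) ^ 2 * τ +
      2 * (Real.pi : ℂ) * Complex.I * ((j : ℂ) + 1 / 2) * (z + 1 / 2))

/-- `α(z,μ) = θ(z)θ(μ+γ)/(θ(z-γ)θ(μ))`. -/
def alphaF (τ γ z μ : ℂ) : ℂ :=
  theta τ z * theta τ (μ + γ) / (theta τ (z - γ) * theta τ μ)

/-- `β(z,μ) = -θ(z+μ)θ(γ)/(θ(z-γ)θ(μ))`. -/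
def betaF (τ γ z μ : ℂ) : ℂ :=
  -(theta τ (z + μ) * theta τ γ) / (theta τ (z - γ) * theta τ μ)

/-- The elliptic dynamical R-matrix of `E_{τ,γ/2}(gl_N)` on `ℂ^N ⊗ ℂ^N`.
Entry `((i,j),(k,l))` is the coefficient of `e_i ⊗ e_j` in `R (e_k ⊗ e_l)`. -/
def Rmat (N : ℕ) (τ γ z : ℂ) (lam : Fin N → ℂ) :
    Matrix (Fin N × Fin N) (Fin N × Fin N) ℂ := fun p q =>
  if p.1 = p.2 then (if q = p then 1 else 0)
  else (if q = p then alphaF τ γ z (lam p.1 - lam p.2) else 0) +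
    (if q = (p.2, p.1) then betaF τ γ z (lam p.1 - lam p.2) else 0)

/-- `λ - γ ∑_{c ∈ S} h^{(c)}` evaluated on the configuration `g` of basis indices. -/
def shiftL {n N : ℕ} (γ : ℂ) (lam : Fin N → ℂ) (S : Finset (Fin n)) (g : Fin n → Fin N) :
    Fin N → ℂ :=
  fun i => lam i - γ * ((S.filter fun c => g c = i).card : ℂ)

/-- `R(z, λ - γ ∑_{c∈S} h^{(c)})^{(a b)}` acting on `(ℂ^N)^{⊗ n}`. -/
def Rop (N n : ℕ) (τ γ z : ℂ) (lam : Fin N → ℂ) (S : Finset (Fin n)) (a b : Fin n) :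
    Matrix (Fin n → Fin N) (Fin n → Fin N) ℂ := fun f g =>
  if ∀ c, c ≠ a → c ≠ b → f c = g c then
    Rmat N τ γ z (shiftL γ lam S g) (f a, f b) (g a, g b)
  else 0

/-- The operators `W_n(z,λ)`, defined recursively:  `W_1 = 1` and
`W_{n+1}(z,λ) = R(z_1-z_2, λ-γ∑_{j=3}^{n+1}h^{(j)})^{(12)} ⋯ R(z_1-z_{n+1},λ)^{(1 n+1)}
  (1 ⊗ W_n(z_2,…,z_{n+1}, λ-γh^{(1)}))` (tensor factors indexed `0,…,n`). -/
def Wrec (N : ℕ) (τ γ : ℂ) : (n : ℕ) → (Fin n → ℂ) → (Fin N → ℂ) →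
    Matrix (Fin n → Fin N) (Fin n → Fin N) ℂ
  | 0, _, _ => 1
  | n + 1, z, lam =>
    (((List.finRange n).map fun j : Fin n =>
      Rop N (n + 1) τ γ (z 0 - z j.succ) lam
        (Finset.univ.filter fun c : Fin (n + 1) => j.succ < c) 0 j.succ).prod) *
      Matrix.of (fun f g : Fin (n + 1) → Fin N =>
        if f 0 = g 0 then
          Wrec N τ γ n (fun j => z j.succ) (fun i => lam i - if g 0 = i then γ else 0)
            (Fin.tail f) (Fin.tail g)
        else 0)

/-- `W^S_n(λ) = W_n(z^S, λ)` with `z^S = (0, γ, 2γ, …, (n-1)γ)`. -/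
def WS (N n : ℕ) (τ γ : ℂ) (lam : Fin N → ℂ) :
    Matrix (Fin n → Fin N) (Fin n → Fin N) ℂ :=
  Wrec N τ γ n (fun j => ((j : ℕ) : ℂ) * γ) lam

/-- `z^∧ = ((n-1)γ, …, 2γ, γ, 0)`. -/
def zWedge (n : ℕ) (γ : ℂ) : Fin n → ℂ := fun j => ((n - 1 - (j : ℕ) : ℕ) : ℂ) * γ

/-- `W^∧_n(λ) = lim_{z → z^∧} ∏_{j=1}^{n-1} (z_j - z_{j+1} - γ) · ρ W_n(z,λ) ρ`,
where `ρ` reverses the order of the tensor factors. -/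
def Wwedge (N n : ℕ) (τ γ : ℂ) (lam : Fin N → ℂ) :
    Matrix (Fin n → Fin N) (Fin n → Fin N) ℂ :=
  limUnder (𝓝[≠] zWedge n γ) fun z : Fin n → ℂ =>
    (∏ j : Fin n, if h : (j : ℕ) + 1 < n then z j - z ⟨(j : ℕ) + 1, h⟩ - γ else 1) •
      Matrix.of fun f g : Fin n → Fin N => Wrec N τ γ n z lam (f ∘ Fin.rev) (g ∘ Fin.rev)

/-- The space `S²(ℂ^N)` of symmetric tensors in `ℂ^N ⊗ ℂ^N`. -/
def symPair (N : ℕ) : Submodule ℂ ((Fin N × Fin N) → ℂ) where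
  carrier := {v | ∀ p : Fin N × Fin N, v p = v (p.2, p.1)}
  add_mem' := by intro a b ha hb p; simp only [Pi.add_apply, ha p, hb p]
  zero_mem' := by intro p; rfl
  smul_mem' := by intro c v hv p; simp only [Pi.smul_apply, hv p]

/-- `R^{reg}(γ,λ) = lim_{z→γ} (z-γ) R(z,λ)`. -/
def Rreg (N : ℕ) (τ γ : ℂ) (lam : Fin N → ℂ) : Matrix (Fin N × Fin N) (Fin N × Fin N) ℂ :=
  limUnder (𝓝[≠] γ) fun z : ℂ => (z - γ) • Rmat N τ γ z lam

/-- The flip `P : u ⊗ v ↦ v ⊗ u` on `ℂ^N ⊗ ℂ^N`. -/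
def Pmat (N : ℕ) : Matrix (Fin N × Fin N) (Fin N × Fin N) ℂ := fun p q =>
  if q = (p.2, p.1) then 1 else 0

/-- The space `S^n(ℂ^N)` of symmetric tensors in `(ℂ^N)^{⊗n}`. -/
def symTensors (N n : ℕ) : Submodule ℂ ((Fin n → Fin N) → ℂ) where
  carrier := {v | ∀ (σ : Equiv.Perm (Fin n)) (f : Fin n → Fin N), v (f ∘ σ) = v f}
  add_mem' := by intro a b ha hb σ f; simp only [Pi.add_apply, ha σ f, hb σ f]
  zero_mem' := by intro σ f; rfl
  smul_mem' := by intro c v hv σ f; simp only [Pi.smul_apply, hv σ f]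

/-- `J_n(ℂ^N)`: the span of tensors `σ v - sign(σ) v`. -/
def Jspan (N n : ℕ) : Submodule ℂ ((Fin n → Fin N) → ℂ) :=
  Submodule.span ℂ {w | ∃ (σ : Equiv.Perm (Fin n)) (v : (Fin n → Fin N) → ℂ),
    w = (fun f => v (f ∘ σ)) - ((Equiv.Perm.sign σ : ℤ) : ℂ) • v}

/-- `ℂ^N ⊗ W ⊆ ℂ^N ⊗ (ℂ^N)^{⊗ n}` for a subspace `W ⊆ (ℂ^N)^{⊗ n}`. -/
def consSlice (N n : ℕ) (W : Submodule ℂ ((Fin n → Fin N) → ℂ)) :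
    Submodule ℂ ((Fin (n + 1) → Fin N) → ℂ) where
  carrier := {v | ∀ i : Fin N, (fun g : Fin n → Fin N => v (Fin.cons i g)) ∈ W}
  add_mem' := by intro a b ha hb i; exact W.add_mem (ha i) (hb i)
  zero_mem' := by intro i; exact W.zero_mem
  smul_mem' := by intro c v hv i; exact W.smul_mem c (hv i)

/-- The `L`-operator of `V^{⊗n}(w)`:
`L(z,λ) = R(z-w, λ-γ∑_{j=2}^n h^{(j)})^{(01)} ⋯ R(z-w-γ(n-1), λ)^{(0n)}`,
acting on `ℂ^N ⊗ (ℂ^N)^{⊗n}` with factors numbered `0,…,n`. -/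
def Lop (N n : ℕ) (τ γ z w : ℂ) (lam : Fin N → ℂ) :
    Matrix (Fin (n + 1) → Fin N) (Fin (n + 1) → Fin N) ℂ :=
  ((List.finRange n).map fun j : Fin n =>
    Rop N (n + 1) τ γ (z - w - (j : ℕ) * γ) lam
      (Finset.univ.filter fun c : Fin (n + 1) => j.succ < c) 0 j.succ).prod

/-- The `L`-operator for the opposite coproduct:
`L'(z,λ) = R(z-w-γ(n-1), λ-γ∑_{j=1}^{n-1} h^{(j)})^{(0n)} ⋯ R(z-w, λ)^{(01)}`. -/
def Lop' (N n : ℕ) (τ γ z w : ℂ) (lam : Fin N → ℂ) :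
    Matrix (Fin (n + 1) → Fin N) (Fin (n + 1) → Fin N) ℂ :=
  (((List.finRange n).reverse).map fun j : Fin n =>
    Rop N (n + 1) τ γ (z - w - (j : ℕ) * γ) lam
      (Finset.univ.filter fun c : Fin (n + 1) => 0 < c ∧ c < j.succ) 0 j.succ).prod

/-- `Id ⊗ M` on `ℂ^N ⊗ (ℂ^N)^{⊗n}`. -/
def idTensor (N n : ℕ) (M : Matrix (Fin n → Fin N) (Fin n → Fin N) ℂ) :
    Matrix (Fin (n + 1) → Fin N) (Fin (n + 1) → Fin N) ℂ :=
  Matrix.of fun f g => if f 0 = g 0 then M (Fin.tail f) (Fin.tail g) else 0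

/-- `Id ⊗ M(λ - γ h^{(0)})` on `ℂ^N ⊗ (ℂ^N)^{⊗n}`. -/
def idTensorShift (N n : ℕ) (γ : ℂ)
    (M : (Fin N → ℂ) → Matrix (Fin n → Fin N) (Fin n → Fin N) ℂ) (lam : Fin N → ℂ) :
    Matrix (Fin (n + 1) → Fin N) (Fin (n + 1) → Fin N) ℂ :=
  Matrix.of fun f g =>
    if f 0 = g 0 then M (fun i => lam i - if g 0 = i then γ else 0) (Fin.tail f) (Fin.tail g)
    else 0

/-- The zero-weight symmetric tensor `e`: the sum of all `e_{i_1} ⊗ ⋯ ⊗ e_{i_n}` over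
sequences in which each index occurs exactly `ℓ` times. -/
def evec (N n ℓ : ℕ) : (Fin n → Fin N) → ℂ := fun f =>
  if ∀ i : Fin N, (Finset.univ.filter fun j => f j = i).card = ℓ then 1 else 0

/-- The multi-index of `ē = e_1^{⊗ℓ} ⊗ ⋯ ⊗ e_N^{⊗ℓ}`. -/
def barIdx (N ℓ : ℕ) : Fin (N * ℓ) → Fin N := fun j =>
  ⟨j.val / ℓ, by
    have h : (j : ℕ) < ℓ * N := by rw [Nat.mul_comm ℓ N]; exact j.isLt
    exact Nat.div_lt_of_lt_mul h⟩

/-- `g_{N,ℓ}(λ) = ∏_{1≤j<k≤N} ∏_{s=1}^ℓ θ(λ_j-λ_k+γs)/θ(λ_j-λ_k-γ(s-1))`. -/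
def gfun (N ℓ : ℕ) (τ γ : ℂ) (lam : Fin N → ℂ) : ℂ :=
  ∏ j : Fin N, ∏ k : Fin N,
    if j < k then
      ∏ s ∈ Finset.Icc 1 ℓ,
        theta τ (lam j - lam k + γ * (s : ℂ)) / theta τ (lam j - lam k - γ * ((s : ℂ) - 1))
    else 1

/-- The permutation induced by a word in the generators `s_1, …, s_n` of `S_{n+1}`:
`π_k = s_{a_1} ∘ ⋯ ∘ s_{a_k}` (letters `a` act as the transposition of `a` and `a+1`). -/
def permOfWord {n : ℕ} : List (Fin n) → Equiv.Perm (Fin (n + 1))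
  | [] => 1
  | a :: rest => Equiv.swap a.castSucc a.succ * permOfWord rest

/-- The product of R-matrices attached to a word (with accumulated permutation `π`):
`W_w(z,λ) = F_k ⋯ F_1` where for the `t`-th letter `a`
`F_t = R(z_{π(a)} - z_{π(a+1)}, λ - γ ∑_{b<a} h^{(π(b))})^{(π(a), π(a+1))}`,
`π = π_{t-1}` the permutation induced by the earlier letters. -/
def Wword (N : ℕ) {n : ℕ} (τ γ : ℂ) (z : Fin (n + 1) → ℂ) (lam : Fin N → ℂ) :
    List (Fin n) → Equiv.Perm (Fin (n + 1)) →
      Matrix (Fin (n + 1) → Fin N) (Fin (n + 1) → Fin N) ℂ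
  | [], _ => 1
  | a :: rest, π =>
      Wword N τ γ z lam rest (π * Equiv.swap a.castSucc a.succ) *
        Rop N (n + 1) τ γ (z (π a.castSucc) - z (π a.succ)) lam
          ((Finset.univ.filter fun c : Fin (n + 1) => (c : ℕ) < (a : ℕ)).image π)
          (π a.castSucc) (π a.succ)

/-- The fused R-matrix `𝓡_{V^{⊗m}(z), V^{⊗n}(w)}(λ)` on `(ℂ^N)^{⊗(m+n)}`
(first block: factors `0,…,m-1`; second block: factors `m,…,m+n-1`). -/
def Rmn (N m n : ℕ) (τ γ z w : ℂ) (lam : Fin N → ℂ) :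
    Matrix (Fin (m + n) → Fin N) (Fin (m + n) → Fin N) ℂ :=
  ((List.finRange m).map fun a : Fin m =>
    ((List.finRange n).map fun j : Fin n =>
      Rop N (m + n) τ γ (z + (a : ℕ) * γ - w - (j : ℕ) * γ) lam
        (Finset.univ.filter fun c : Fin (m + n) =>
          (c : ℕ) < (a : ℕ) ∨ m + (j : ℕ) < (c : ℕ))
        (Fin.castAdd n a) (Fin.natAdd m j)).prod).prod

/-- `A ⊗ B ⊆ (ℂ^N)^{⊗m} ⊗ (ℂ^N)^{⊗n}`, realised as `(A ⊗ V₂) ∩ (V₁ ⊗ B)`. -/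
def blockSub (N m n : ℕ) (A : Submodule ℂ ((Fin m → Fin N) → ℂ))
    (B : Submodule ℂ ((Fin n → Fin N) → ℂ)) :
    Submodule ℂ ((Fin (m + n) → Fin N) → ℂ) where
  carrier := {v |
    (∀ g : Fin n → Fin N, (fun f : Fin m → Fin N => v (Fin.append f g)) ∈ A) ∧
    ∀ f : Fin m → Fin N, (fun g : Fin n → Fin N => v (Fin.append f g)) ∈ B}
  add_mem' := by
    intro x y hx hy
    exact ⟨fun g => A.add_mem (hx.1 g) (hy.1 g), fun f => B.add_mem (hx.2 f) (hy.2 f)⟩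
  zero_mem' := ⟨fun _ => A.zero_mem, fun _ => B.zero_mem⟩
  smul_mem' := by
    intro c x hx
    exact ⟨fun g => A.smul_mem c (hx.1 g), fun f => B.smul_mem c (hx.2 f)⟩

/-- Matrix element `L_{jk}(z,λ)` of the `L`-operator (evaluation point `w = 0`),
as an operator on `(ℂ^N)^{⊗n}`: `L(z,λ)(e_k ⊗ v) = ∑_j e_j ⊗ L_{jk}(z,λ) v`. -/
def LmatEl (N n : ℕ) (τ γ z : ℂ) (lam : Fin N → ℂ) (j k : Fin N)
    (v : (Fin n → Fin N) → ℂ) : (Fin n → Fin N) → ℂ := fun g =>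
  (Lop N n τ γ z 0 lam).mulVec
    (fun f => (if f 0 = k then (1 : ℂ) else 0) * v (Fin.tail f)) (Fin.cons j g)

/-- `L_{j_{σ(1)} j_1}(z, λ-γ(ω_{j_2}+⋯+ω_{j_m})) ∘ ⋯ ∘ L_{j_{σ(m)} j_m}(z-(m-1)γ, λ)`. -/
def chainT (N n m : ℕ) (τ γ z : ℂ) (lam : Fin N → ℂ) (jt : Fin m → Fin N)
    (σ : Equiv.Perm (Fin m)) (v : (Fin n → Fin N) → ℂ) : (Fin n → Fin N) → ℂ :=
  (List.finRange m).foldr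
    (fun (t : Fin m) acc =>
      LmatEl N n τ γ (z - (t.val : ℂ) * γ)
        (fun i => lam i -
          γ * ((Finset.univ.filter fun s : Fin m => t < s ∧ jt s = i).card : ℂ))
        (jt (σ t)) (jt t) acc)
    v

/-- The transfer matrix `T_m(z)`, acting on scalar functions of `λ` via the identification
of the zero weight space of `S^{Nℓ}(ℂ^N)` with `ℂ` by the basis vector `e`:
`T_m(z) f(λ) = ∑_{j_1<⋯<j_m} ∑_{σ} (-1)^σ [L_{j_{σ(1)} j_1}(z,λ-γ(ω_{j_2}+⋯+ω_{j_m})) ⋯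
L_{j_{σ(m)} j_m}(z-(m-1)γ, λ)] e · f(λ-γ(ω_{j_1}+⋯+ω_{j_m}))`. -/
def Tm (N ℓ m : ℕ) (τ γ z : ℂ) (lam : Fin N → ℂ) (f : (Fin N → ℂ) → ℂ) : ℂ :=
  ∑ jt ∈ Finset.univ.filter fun jt : Fin m → Fin N => ∀ s t : Fin m, s < t → jt s < jt t,
    ∑ σ : Equiv.Perm (Fin m),
      ((Equiv.Perm.sign σ : ℤ) : ℂ) *
        chainT N (N * ℓ) m τ γ z lam jt σ (evec N (N * ℓ) ℓ) (barIdx N ℓ) *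
        f fun i => lam i - if ∃ t, jt t = i then γ else 0

/-- The `m`-th Ruijsenaars operator with coupling constant `ℓ`:
`M_m f(λ) = ∑_{|J|=m} ∏_{j∈J,k∉J} θ(λ_j-λ_k+ℓγ)/θ(λ_j-λ_k) · f(λ-γ∑_{j∈J}ω_j)`. -/
def Mm (N ℓ m : ℕ) (τ γ : ℂ) (f : (Fin N → ℂ) → ℂ) (lam : Fin N → ℂ) : ℂ :=
  ∑ J ∈ Finset.powersetCard m (Finset.univ : Finset (Fin N)),
    (∏ j ∈ J, ∏ k ∈ Jᶜ, theta τ (lam j - lam k + (ℓ : ℂ) * γ) / theta τ (lam j - lam k)) *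
      f fun i => lam i - if i ∈ J then γ else 0

/-- The transfer matrix with auxiliary space indexed by `ι` (weights `wt`) and quantum
space indexed by `ι₃`: `T f(λ) = ∑_μ tr_{W[μ]}(𝓡(λ)) f(λ-γμ)`. -/
def transferOp {N : ℕ} {ι ι₃ : Type} [Fintype ι] [Fintype ι₃] (γ : ℂ)
    (wt : ι → Fin N → ℂ) (R : (Fin N → ℂ) → Matrix (ι × ι₃) (ι × ι₃) ℂ)
    (f : (Fin N → ℂ) → ι₃ → ℂ) : (Fin N → ℂ) → ι₃ → ℂ := fun lam b =>
  ∑ a : ι, ∑ b' : ι₃, R lam (a, b) (a, b') * f (fun r => lam r - γ * wt a r) b'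

/-- The Coxeter relations of type `A` for the generators `t 0, …, t (n-1)`. -/
structure IsCoxeterA {M : Type*} [Monoid M] (t : ℕ → M) (n : ℕ) : Prop where
  sq : ∀ i < n, t i * t i = 1
  braid : ∀ i, i + 1 < n → t i * t (i + 1) * t i = t (i + 1) * t i * t (i + 1)
  comm : ∀ i j, i + 1 < j → j < n → t i * t j = t j * t i

/-- The descending product `t (n-1) * t (n-2) * ⋯ * t k`. -/
def descProd {M : Type*} [Monoid M] (t : ℕ → M) (k : ℕ) : ℕ → M
  | 0 => 1
  | n + 1 => if k ≤ n then t n * descProd t k n else 1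

section descProd

variable {M : Type*} [Monoid M] {t : ℕ → M}

theorem descProd_of_le {k n : ℕ} (h : n ≤ k) : descProd t k n = 1 := by
  cases n with
  | zero => rfl
  | succ n => simp [descProd, show ¬ k ≤ n by omega]

theorem descProd_succ {k n : ℕ} (h : k ≤ n) :
    descProd t k (n + 1) = t n * descProd t k n := by
  simp [descProd, h]

theorem descProd_eq_mul {k n : ℕ} (h : k < n) :
    descProd t k n = descProd t (k + 1) n * t k := by
  induction n with
  | zero => omega
  | succ n ih =>
    rcases Nat.lt_succ_iff_lt_or_eq.1 h with h | rfl
    · rw [descProd_succ h.le, descProd_succ h, ih h, mul_assoc]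
    · rw [descProd_succ le_rfl, descProd_of_le le_rfl, descProd_of_le le_rfl, mul_one, one_mul]

namespace IsCoxeterA

variable {n : ℕ}

theorem mono (ht : IsCoxeterA t n) {m : ℕ} (h : m ≤ n) : IsCoxeterA t m :=
  ⟨fun i hi => ht.sq i (hi.trans_le h), fun i hi => ht.braid i (hi.trans_le h),
    fun i j hij hj => ht.comm i j hij (hj.trans_le h)⟩

theorem mul_descProd_of_lt (ht : IsCoxeterA t n) {a k m : ℕ} (hm : m ≤ n) (h : a + 1 < k) :
    descProd t k m * t a = t a * descProd t k m := by
  induction m with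
  | zero => simp [descProd]
  | succ m ih =>
    by_cases hk : k ≤ m
    · rw [descProd_succ hk, mul_assoc, ih (by omega), ← mul_assoc, ← mul_assoc,
        ht.comm a m (by omega) (by omega)]
    · simp [descProd, hk]

theorem descProd_mul_of_lt (ht : IsCoxeterA t n) {a k m : ℕ} (h : m < a) (ha : a < n) :
    descProd t k m * t a = t a * descProd t k m := by
  induction m with
  | zero => simp [descProd]
  | succ m ih =>
    by_cases hk : k ≤ m
    · rw [descProd_succ hk, mul_assoc, ih (by omega), ← mul_assoc, ← mul_assoc,
        ht.comm m a h ha]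
    · simp [descProd, hk]

theorem descProd_mul_succ (ht : IsCoxeterA t n) {b k m : ℕ} (hm : m ≤ n) (hk : k ≤ b)
    (hb : b + 1 < m) : descProd t k m * t (b + 1) = t b * descProd t k m := by
  induction m with
  | zero => omega
  | succ m ih =>
    rw [descProd_succ (by omega)]
    rcases Nat.lt_succ_iff_lt_or_eq.1 hb with hb | rfl
    · rw [mul_assoc, ih (by omega) hb, ← mul_assoc, ← mul_assoc, ht.comm b m hb (by omega)]
    · rw [descProd_succ hk, mul_assoc, mul_assoc, ht.descProd_mul_of_lt (by omega) (by omega)]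
      simp only [← mul_assoc]
      rw [ht.braid b (by omega)]

theorem exists_eq_mul_descProd (ht : IsCoxeterA t (n + 1)) (w : List ℕ)
    (hw : ∀ a ∈ w, a < n + 1) :
    ∃ u : List ℕ, (∀ a ∈ u, a < n) ∧ ∃ k ≤ n + 1,
      (w.map t).prod = (u.map t).prod * descProd t k (n + 1) := by
  induction w using List.reverseRecOn with
  | nil => exact ⟨[], by simp, n + 1, le_rfl, by simp [descProd_of_le]⟩
  | append_singleton w a ih =>
    obtain ⟨u, hu, k, hk, h⟩ := ih fun b hb => hw b (by simp [hb])
    have ha : a < n + 1 := hw a (by simp)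
    simp only [List.map_append, List.map_cons, List.map_nil, List.prod_append, List.prod_cons,
      List.prod_nil, mul_one, h, mul_assoc]
    rcases lt_trichotomy a k with h1 | rfl | h1
    · rcases Nat.lt_or_ge (a + 1) k with h2 | h2
      · exact ⟨u ++ [a], List.forall_mem_append.2 ⟨hu, by simp; omega⟩,
          k, hk, by simp [ht.mul_descProd_of_lt le_rfl h2, mul_assoc]⟩
      · obtain rfl : k = a + 1 := by omega
        exact ⟨u, hu, a, by omega, by rw [← descProd_eq_mul ha]⟩
    · exact ⟨u, hu, a + 1, by omega, by
        rw [descProd_eq_mul ha, mul_assoc, ht.sq a ha, mul_one]⟩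
    · obtain ⟨b, rfl⟩ : ∃ b, a = b + 1 := ⟨a - 1, by omega⟩
      have hb := ht.descProd_mul_succ (m := n + 1) (b := b) le_rfl (show k ≤ b by omega) (by omega)
      exact ⟨u ++ [b], List.forall_mem_append.2 ⟨hu, by simp; omega⟩,
        k, hk, by simp [hb, mul_assoc]⟩

end IsCoxeterA

end descProd

theorem swap_braid {α : Type*} [DecidableEq α] {x y z : α} (hxy : x ≠ y) (hxz : x ≠ z)
    (hyz : y ≠ z) : Equiv.swap x y * Equiv.swap y z * Equiv.swap x y =
      Equiv.swap y z * Equiv.swap x y * Equiv.swap y z := by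
  rw [Equiv.swap_comm x y, Equiv.swap_comm y z, Equiv.swap_mul_swap_mul_swap hyz.symm hxz.symm,
    Equiv.swap_comm z y, Equiv.swap_comm y x, Equiv.swap_mul_swap_mul_swap hxy hxz,
    Equiv.swap_comm]

/-- The adjacent transposition of `i` and `i + 1`. -/
abbrev adjSwap (i : ℕ) : Equiv.Perm ℕ := Equiv.swap i (i + 1)

theorem isCoxeterA_adjSwap (n : ℕ) : IsCoxeterA adjSwap n where
  sq i _ := Equiv.swap_mul_self _ _
  braid i _ := swap_braid (by omega) (by omega) (by omega)
  comm i j hij _ := (Equiv.Perm.disjoint_swap_swap (by simp; omega)).commute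

theorem descProd_adjSwap_apply {k n : ℕ} (h : k ≤ n) : descProd adjSwap k n k = n := by
  induction n with
  | zero => simp [descProd]; omega
  | succ n ih =>
    rcases Nat.le_succ_iff.1 h with h | rfl
    · rw [descProd_succ h, Equiv.Perm.mul_apply, ih h, Equiv.swap_apply_left]
    · simp [descProd_of_le]

theorem prod_adjSwap_apply_of_lt {n m : ℕ} (hm : n < m) (u : List ℕ) (hu : ∀ a ∈ u, a < n) :
    (u.map adjSwap).prod m = m := by
  induction u with
  | nil => rfl
  | cons a u ih =>
    have ha := hu a (by simp)
    rw [List.map_cons, List.prod_cons, Equiv.Perm.mul_apply, ih fun b hb => hu b (by simp [hb]),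
      Equiv.swap_apply_of_ne_of_ne (by omega) (by omega)]

/-- Words in the adjacent transpositions with the same product have the same image under every
assignment satisfying the Coxeter relations. -/
theorem IsCoxeterA.prod_eq_prod {M : Type*} [Monoid M] {t : ℕ → M} {n : ℕ}
    (ht : IsCoxeterA t n) {w w' : List ℕ} (hw : ∀ a ∈ w, a < n) (hw' : ∀ a ∈ w', a < n)
    (h : (w.map adjSwap).prod = (w'.map adjSwap).prod) :
    (w.map t).prod = (w'.map t).prod := by
  induction n generalizing w w' with
  | zero =>
    obtain rfl : w = [] := List.eq_nil_iff_forall_not_mem.2 fun a ha => by simpa using hw a ha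
    obtain rfl : w' = [] := List.eq_nil_iff_forall_not_mem.2 fun a ha => by simpa using hw' a ha
    rfl
  | succ n ih =>
    let T : ℕ → M × Equiv.Perm ℕ := fun i => (t i, adjSwap i)
    have hs := isCoxeterA_adjSwap (n + 1)
    have hT : IsCoxeterA T (n + 1) :=
      ⟨fun i hi => Prod.ext (ht.sq i hi) (hs.sq i hi),
        fun i hi => Prod.ext (ht.braid i hi) (hs.braid i hi),
        fun i j hij hj => Prod.ext (ht.comm i j hij hj) (hs.comm i j hij hj)⟩
    have fst_prod : ∀ v : List ℕ, (v.map T).prod.1 = (v.map t).prod := fun v => by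
      induction v <;> simp_all [T]
    have snd_prod : ∀ v : List ℕ, (v.map T).prod.2 = (v.map adjSwap).prod := fun v => by
      induction v <;> simp_all [T]
    have fst_desc : ∀ k m, (descProd T k m).1 = descProd t k m := fun k m => by
      induction m with
      | zero => rfl
      | succ m ihm => by_cases hk : k ≤ m <;> simp [descProd, hk, ihm, T]
    have snd_desc : ∀ k m, (descProd T k m).2 = descProd adjSwap k m := fun k m => by
      induction m with
      | zero => rfl
      | succ m ihm => by_cases hk : k ≤ m <;> simp [descProd, hk, ihm, T]
    obtain ⟨u, hu, k, hk, e⟩ := hT.exists_eq_mul_descProd w hw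
    obtain ⟨u', hu', k', hk', e'⟩ := hT.exists_eq_mul_descProd w' hw'
    have e1 := congrArg Prod.fst e
    have e2 := congrArg Prod.snd e
    have e1' := congrArg Prod.fst e'
    have e2' := congrArg Prod.snd e'
    simp only [Prod.fst_mul, Prod.snd_mul, fst_prod, snd_prod, fst_desc, snd_desc]
      at e1 e2 e1' e2'
    have hkk : k = k' := by
      apply (w.map adjSwap).prod.injective
      rw [e2, Equiv.Perm.mul_apply, descProd_adjSwap_apply hk,
        prod_adjSwap_apply_of_lt n.lt_succ_self u hu, ← e2, h, e2', Equiv.Perm.mul_apply,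
        descProd_adjSwap_apply hk', prod_adjSwap_apply_of_lt n.lt_succ_self u' hu']
    subst hkk
    rw [e1, e1', ih (ht.mono n.le_succ) hu hu' (mul_right_cancel (e2.symm.trans (h.trans e2')))]

section Theta

variable {τ : ℂ}

/-- The general term of the series defining `theta`. -/
def thetaTerm (τ z : ℂ) (j : ℤ) : ℂ :=
  Complex.exp ((Real.pi : ℂ) * Complex.I * ((j : ℂ) + 1 / 2) ^ 2 * τ +
      2 * (Real.pi : ℂ) * Complex.I * ((j : ℂ) + 1 / 2) * (z + 1 / 2))

theorem theta_eq_neg_tsum (τ z : ℂ) : theta τ z = -∑' j : ℤ, thetaTerm τ z j := rfl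

theorem thetaTerm_eq (τ z : ℂ) (j : ℤ) :
    thetaTerm τ z j = Complex.exp (Real.pi * Complex.I * τ / 4 + Real.pi * Complex.I * (z + 1 / 2)) *
      jacobiTheta₂_term j (z + 1 / 2 + τ / 2) τ := by
  rw [thetaTerm, jacobiTheta₂_term, ← Complex.exp_add]
  ring_nf

theorem theta_eq_jacobiTheta₂ (τ z : ℂ) :
    theta τ z = -(Complex.exp (Real.pi * Complex.I * τ / 4 + Real.pi * Complex.I * (z + 1 / 2)) *
      jacobiTheta₂ (z + 1 / 2 + τ / 2) τ) := by
  simp only [theta_eq_neg_tsum, thetaTerm_eq, tsum_mul_left, jacobiTheta₂]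

theorem summable_thetaTerm (hτ : 0 < τ.im) (z : ℂ) : Summable (thetaTerm τ z) := by
  simp only [funext (thetaTerm_eq τ z)]
  exact ((summable_jacobiTheta₂_term_iff _ _).2 hτ).mul_left _

theorem thetaTerm_neg (τ z : ℂ) (j : ℤ) : thetaTerm τ (-z) (-1 - j) = -thetaTerm τ z j := by
  have h : Complex.exp (-(2 * Real.pi * Complex.I * ((j : ℂ) + 1 / 2))) = -1 := by
    rw [show -(2 * Real.pi * Complex.I * ((j : ℂ) + 1 / 2)) =
      ((-j - 1 : ℤ) : ℂ) * (2 * Real.pi * Complex.I) + Real.pi * Complex.I by push_cast; ring,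
      Complex.exp_add, Complex.exp_int_mul_two_pi_mul_I, Complex.exp_pi_mul_I, one_mul]
  rw [← mul_neg_one (thetaTerm τ z j), ← h, thetaTerm, thetaTerm, ← Complex.exp_add]
  push_cast
  ring_nf

theorem theta_neg (τ z : ℂ) : theta τ (-z) = -theta τ z := by
  rw [theta_eq_neg_tsum, theta_eq_neg_tsum,
    ← (Equiv.subLeft (-1 : ℤ)).tsum_eq (thetaTerm τ (-z))]
  simp only [Equiv.subLeft_apply, thetaTerm_neg, tsum_neg]

theorem differentiable_theta (hτ : 0 < τ.im) : Differentiable ℂ (theta τ) := by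
  have h : theta τ = fun z => -(Complex.exp (Real.pi * Complex.I * τ / 4 +
      Real.pi * Complex.I * (z + 1 / 2)) * jacobiTheta₂ (z + 1 / 2 + τ / 2) τ) :=
    funext (theta_eq_jacobiTheta₂ τ)
  rw [h]
  intro z
  have h1 : DifferentiableAt ℂ (fun z : ℂ => jacobiTheta₂ (z + 1 / 2 + τ / 2) τ) z :=
    (differentiableAt_jacobiTheta₂_fst (z + 1 / 2 + τ / 2) hτ).comp z
      (f := fun z : ℂ => z + 1 / 2 + τ / 2) (by fun_prop)
  fun_prop

theorem exists_jacobiTheta₂_ne_zero (hτ : 0 < τ.im) : ∃ z, jacobiTheta₂ z τ ≠ 0 := by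
  by_contra! h
  have hsum : HasSum (fun n : ℤ => ∫ x in (0 : ℝ)..1, jacobiTheta₂_term n x τ)
      (∫ x in (0 : ℝ)..1, jacobiTheta₂ x τ) := by
    refine intervalIntegral.hasSum_integral_of_dominated_convergence
      (fun n _ => ‖jacobiTheta₂_term n 0 τ‖) (fun n => ?_) (fun n => ?_) ?_ ?_ ?_
    · refine Continuous.aestronglyMeasurable ?_
      simp only [jacobiTheta₂_term]
      fun_prop
    · refine MeasureTheory.ae_of_all _ fun x _ => ?_
      simp [norm_jacobiTheta₂_term]
    · exact MeasureTheory.ae_of_all _ fun x _ =>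
        ((summable_jacobiTheta₂_term_iff 0 τ).2 hτ).norm
    · exact intervalIntegrable_const
    · exact MeasureTheory.ae_of_all _ fun x _ => hasSum_jacobiTheta₂_term x hτ
  have hint : ∀ n : ℤ, n ≠ 0 → ∫ x in (0 : ℝ)..1, jacobiTheta₂_term n x τ = 0 := fun n hn => by
    have hc : 2 * (Real.pi : ℂ) * Complex.I * n ≠ 0 := by simp [Real.pi_ne_zero, hn]
    simp only [jacobiTheta₂_term, Complex.exp_add]
    rw [intervalIntegral.integral_mul_const, integral_exp_mul_complex hc]
    have : Complex.exp (2 * Real.pi * Complex.I * n) = 1 := by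
      rw [mul_comm, Complex.exp_int_mul_two_pi_mul_I]
    simp [this]
  have h1 := (hasSum_single 0 hint).unique hsum
  simp [h, jacobiTheta₂_term] at h1

theorem exists_theta_ne_zero (hτ : 0 < τ.im) : ∃ z, theta τ z ≠ 0 := by
  obtain ⟨z, hz⟩ := exists_jacobiTheta₂_ne_zero hτ
  refine ⟨z - 1 / 2 - τ / 2, ?_⟩
  rw [theta_eq_jacobiTheta₂, neg_ne_zero]
  refine mul_ne_zero (Complex.exp_ne_zero _) ?_
  convert hz using 2
  ring

theorem isOpen_theta_ne_zero (hτ : 0 < τ.im) : IsOpen {z | theta τ z ≠ 0} :=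
  isOpen_ne_fun (differentiable_theta hτ).continuous continuous_const

theorem dense_theta_ne_zero (hτ : 0 < τ.im) : Dense {z | theta τ z ≠ 0} := by
  obtain ⟨z₀, hz₀⟩ := exists_theta_ne_zero hτ
  have ha : AnalyticOnNhd ℂ (theta τ) Set.univ :=
    (differentiable_theta hτ).differentiableOn.analyticOnNhd isOpen_univ
  intro z
  rw [mem_closure_iff_frequently]
  intro hz
  apply hz₀
  have h : theta τ =ᶠ[𝓝 z] 0 := hz.mono fun w hw => by simpa using hw
  exact ha.eqOn_zero_of_preconnected_of_eventuallyEq_zero isPreconnected_univ (Set.mem_univ z) h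
    (Set.mem_univ z₀)

/-- Terms of the even-index half of a theta series of modulus `2τ`. -/
def evenTerm (τ x : ℂ) (m : ℤ) : ℂ :=
  Complex.exp (2 * Real.pi * Complex.I * (m ^ 2 * τ + 2 * m * x))

/-- Terms of the odd-index half of a theta series of modulus `2τ`. -/
def oddTerm (τ x : ℂ) (m : ℤ) : ℂ :=
  Complex.exp (2 * Real.pi * Complex.I * ((m + 1 / 2) ^ 2 * τ + 2 * (m + 1 / 2) * x))

theorem summable_evenTerm (hτ : 0 < τ.im) (x : ℂ) : Summable (evenTerm τ x) := by
  have h := (summable_jacobiTheta₂_term_iff (2 * x) (2 * τ)).2 (by simpa using hτ)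
  refine h.congr fun m => ?_
  rw [jacobiTheta₂_term, evenTerm]
  ring_nf

theorem summable_oddTerm (hτ : 0 < τ.im) (x : ℂ) : Summable (oddTerm τ x) := by
  have h := (summable_jacobiTheta₂_term_iff (2 * x + τ) (2 * τ)).2 (by simpa using hτ)
  refine (h.mul_left (Complex.exp (Real.pi * Complex.I * (τ / 2 + 2 * x)))).congr fun m => ?_
  rw [jacobiTheta₂_term, oddTerm, ← Complex.exp_add]
  ring_nf

/-- The pairs `(m + l, m - l - 1)` and `(m + l, m - l)` exhaust `ℤ × ℤ` by the parity of the sum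
of the coordinates. -/
def parityEquiv : (ℤ × ℤ) ⊕ (ℤ × ℤ) ≃ ℤ × ℤ :=
  Equiv.ofBijective
    (Sum.elim (fun p => (p.1 + p.2, p.1 - p.2 - 1)) fun p => (p.1 + p.2, p.1 - p.2)) <| by
    constructor
    · rintro (⟨a, b⟩ | ⟨a, b⟩) (⟨c, d⟩ | ⟨c, d⟩) h <;>
        simp only [Sum.elim_inl, Sum.elim_inr, Prod.mk.injEq] at h <;>
        simp only [Sum.inl.injEq, Sum.inr.injEq, Prod.mk.injEq, reduceCtorEq] <;> omega
    · rintro ⟨j, k⟩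
      rcases Int.even_or_odd' (j + k) with ⟨m, h | h⟩
      · exact ⟨Sum.inr (m, j - m), by simp; omega⟩
      · exact ⟨Sum.inl (m + 1, j - m - 1), by simp; omega⟩

theorem thetaTerm_mul_inl (τ x y : ℂ) (m l : ℤ) :
    thetaTerm τ (x + y) (m + l) * thetaTerm τ (x - y) (m - l - 1) =
      evenTerm τ x m * oddTerm τ y l := by
  have h : Complex.exp ((m : ℤ) * (2 * Real.pi * Complex.I)) = 1 :=
    Complex.exp_int_mul_two_pi_mul_I m
  rw [← mul_one (_ * oddTerm _ _ _), ← h, thetaTerm, thetaTerm, evenTerm, oddTerm,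
    ← Complex.exp_add, ← Complex.exp_add, ← Complex.exp_add]
  push_cast
  ring_nf

theorem thetaTerm_mul_inr (τ x y : ℂ) (m l : ℤ) :
    thetaTerm τ (x + y) (m + l) * thetaTerm τ (x - y) (m - l) =
      -(oddTerm τ x m * evenTerm τ y l) := by
  have h : Complex.exp ((m : ℤ) * (2 * Real.pi * Complex.I) + Real.pi * Complex.I) = -1 := by
    rw [Complex.exp_add, Complex.exp_int_mul_two_pi_mul_I, Complex.exp_pi_mul_I, one_mul]
  rw [← mul_neg_one (_ * _), thetaTerm, thetaTerm, evenTerm, oddTerm, ← h,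
    ← Complex.exp_add, ← Complex.exp_add, ← Complex.exp_add]
  push_cast
  ring_nf

theorem theta_add_mul_theta_sub (hτ : 0 < τ.im) (x y : ℂ) :
    theta τ (x + y) * theta τ (x - y) =
      (∑' m, evenTerm τ x m) * (∑' m, oddTerm τ y m) -
        (∑' m, oddTerm τ x m) * (∑' m, evenTerm τ y m) := by
  have hprod : ∀ {f g : ℤ → ℂ}, Summable f → Summable g →
      HasSum (fun p : ℤ × ℤ => f p.1 * g p.2) ((∑' m, f m) * ∑' m, g m) := fun hf hg => by
    rw [tsum_mul_tsum_of_summable_norm hf.norm hg.norm]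
    exact (summable_mul_of_summable_norm hf.norm hg.norm).hasSum
  have h := hprod (summable_thetaTerm hτ (x + y)) (summable_thetaTerm hτ (x - y))
  have h1 := hprod (summable_evenTerm hτ x) (summable_oddTerm hτ y)
  have h2 := (hprod (summable_oddTerm hτ x) (summable_evenTerm hτ y)).neg
  rw [theta_eq_neg_tsum, theta_eq_neg_tsum, neg_mul_neg,
    sub_eq_add_neg (_ * _)]
  refine (parityEquiv.hasSum_iff.2 h).unique (HasSum.sum ?_ ?_)
  · exact h1.congr_fun fun p => thetaTerm_mul_inl τ x y p.1 p.2
  · exact h2.congr_fun fun p => thetaTerm_mul_inr τ x y p.1 p.2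

/-- The three-term (Weierstrass) identity of the theta function. -/
theorem theta_three_term (hτ : 0 < τ.im) (a b c d : ℂ) :
    theta τ (a + b) * theta τ (a - b) * (theta τ (c + d) * theta τ (c - d)) -
      theta τ (a + c) * theta τ (a - c) * (theta τ (b + d) * theta τ (b - d)) +
      theta τ (a + d) * theta τ (a - d) * (theta τ (b + c) * theta τ (b - c)) = 0 := by
  simp only [theta_add_mul_theta_sub hτ]
  ring

end Theta

section Weights

variable {τ γ : ℂ}

theorem alphaF_mul_comm (τ γ z w p q : ℂ) :
    alphaF τ γ z p * alphaF τ γ w q = alphaF τ γ w p * alphaF τ γ z q := by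
  simp only [alphaF, div_mul_div_comm]
  congr 1 <;> ring

theorem alphaF_neg_mul_add (hτ : 0 < τ.im) {z u : ℂ} (hz : theta τ (z - γ) ≠ 0)
    (hz' : theta τ (-z - γ) ≠ 0) (hu : theta τ u ≠ 0) :
    alphaF τ γ (-z) (-u) * alphaF τ γ z u + betaF τ γ (-z) (-u) * betaF τ γ z (-u) = 1 := by
  have F := theta_three_term hτ z u γ 0
  rw [show -z - γ = -(z + γ) by ring, theta_neg, neg_ne_zero] at hz'
  simp only [alphaF, betaF, show -z - γ = -(z + γ) by ring, show -z + -u = -(z + u) by ring,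
    show -u + γ = -(u - γ) by ring, show z + -u = z - u by ring, theta_neg]
  simp only [add_zero, sub_zero] at F
  field_simp
  linear_combination F

theorem alphaF_neg_mul_add_eq_zero {z u : ℂ} (hz : theta τ (z - γ) ≠ 0)
    (hz' : theta τ (-z - γ) ≠ 0) (hu : theta τ u ≠ 0) :
    alphaF τ γ (-z) (-u) * betaF τ γ z u + betaF τ γ (-z) (-u) * alphaF τ γ z (-u) = 0 := by
  simp only [alphaF, betaF, show -z + -u = -(z + u) by ring, theta_neg]
  field_simp
  ring

theorem weight_identity_distinct (hτ : 0 < τ.im) {x y u v : ℂ} (hx : theta τ (x - γ) ≠ 0)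
    (hy : theta τ (y - γ) ≠ 0) (hxy : theta τ (x + y - γ) ≠ 0) (hu : theta τ u ≠ 0)
    (hv : theta τ v ≠ 0) (huv : theta τ (u + v) ≠ 0) :
    alphaF τ γ x u * betaF τ γ (x + y) (u + v) * betaF τ γ y (-u) +
        betaF τ γ x u * betaF τ γ (x + y) v * alphaF τ γ y u =
      betaF τ γ y v * alphaF τ γ (x + y) u * betaF τ γ x (u + v) := by
  have F : -(theta τ x * theta τ (x + y + (u + v)) * theta τ (y - u) * theta τ v) +
      theta τ y * theta τ (x + u) * theta τ (x + y + v) * theta τ (u + v) -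
      theta τ (x + y) * theta τ (y + v) * theta τ (x + (u + v)) * theta τ u = 0 := by
    linear_combination (norm := ring_nf) -theta_three_term hτ
      (x + (y + u + v) / 2) ((y + u + v) / 2) ((y - u + v) / 2) ((y - u - v) / 2)
  simp only [alphaF, betaF, ← sub_eq_add_neg, theta_neg]
  linear_combination (norm := (field_simp; ring)) theta τ γ ^ 2 * theta τ (u + γ) /
    (theta τ (x - γ) * theta τ (y - γ) * theta τ (x + y - γ) * theta τ u *
      (theta τ u * theta τ v * theta τ (u + v))) * F

theorem weight_identity_left (hτ : 0 < τ.im) {x y u : ℂ} (hx : theta τ (x - γ) ≠ 0)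
    (hy : theta τ (y - γ) ≠ 0) (hxy : theta τ (x + y - γ) ≠ 0) (hu : theta τ u ≠ 0)
    (hu' : theta τ (u - γ) ≠ 0) :
    alphaF τ γ (x + y) u * betaF τ γ y (u - γ) =
      alphaF τ γ y u * betaF τ γ (x + y) (u - γ) * betaF τ γ x (-u) +
        betaF τ γ y u * alphaF τ γ x u := by
  have F : -(theta τ (x + y) * theta τ (y + (u - γ)) * theta τ (x - γ) * theta τ u) +
      theta τ y * theta τ (x + y + (u - γ)) * theta τ (x - u) * theta τ γ +
      theta τ (y + u) * theta τ x * theta τ (x + y - γ) * theta τ (u - γ) = 0 := by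
    linear_combination (norm := ring_nf) theta_three_term hτ
      ((x + u - γ) / 2 + y) ((x + u - γ) / 2) ((x - u + γ) / 2) ((x - u - γ) / 2)
  simp only [alphaF, betaF, ← sub_eq_add_neg, theta_neg]
  linear_combination (norm := (field_simp; ring)) theta τ γ * theta τ (u + γ) /
    (theta τ (x - γ) * theta τ (y - γ) * theta τ (x + y - γ) * theta τ u *
      (theta τ u * theta τ (u - γ))) * F

theorem weight_identity_swap (hτ : 0 < τ.im) {x y u : ℂ} (hx : theta τ (x - γ) ≠ 0)
    (hy : theta τ (y - γ) ≠ 0) (hxy : theta τ (x + y - γ) ≠ 0) (hu : theta τ u ≠ 0)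
    (hu' : theta τ (u - γ) ≠ 0) :
    betaF τ γ (x + y) u =
      alphaF τ γ y u * betaF τ γ (x + y) (u - γ) * alphaF τ γ x (-u) +
        betaF τ γ y u * betaF τ γ x u := by
  have F : -(theta τ (x + y + u) * theta τ (x - γ) * theta τ (y - γ) * theta τ u) +
      theta τ x * theta τ y * theta τ (x + y + (u - γ)) * theta τ (u + γ) -
      theta τ (x + y - γ) * theta τ (y + u) * theta τ (x + u) * theta τ γ = 0 := by
    linear_combination (norm := ring_nf) -theta_three_term hτ
      (x + (y + u - γ) / 2) ((y + u + γ) / 2) ((y + u - γ) / 2) ((y - u - γ) / 2)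
  simp only [alphaF, betaF, show -u + γ = -(u - γ) by ring, theta_neg]
  linear_combination (norm := (field_simp; ring)) theta τ γ /
    (theta τ (x - γ) * theta τ (y - γ) * theta τ (x + y - γ) * theta τ u ^ 2) * F

theorem weight_identity_middle (hτ : 0 < τ.im) {x y u : ℂ} (hx : theta τ (x - γ) ≠ 0)
    (hy : theta τ (y - γ) ≠ 0) (hxy : theta τ (x + y - γ) ≠ 0) (hu : theta τ u ≠ 0)
    (hu' : theta τ (u - γ) ≠ 0) :
    alphaF τ γ x (u - γ) * betaF τ γ y (γ - u) +
        betaF τ γ x (u - γ) * betaF τ γ (x + y) (-u) * alphaF τ γ y (u - γ) =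
      betaF τ γ y (-u) * alphaF τ γ (x + y) (u - γ) := by
  have F : theta τ x * theta τ (x + y - γ) * theta τ (y + γ - u) * theta τ u -
      theta τ (x + (u - γ)) * theta τ (x + y - u) * theta τ γ * theta τ y -
      theta τ (y - u) * theta τ (u - γ) * theta τ (x + y) * theta τ (x - γ) = 0 := by
    linear_combination (norm := ring_nf) -theta_three_term hτ
      ((x - u) / 2 + y) ((x + u) / 2) ((x + u) / 2 - γ) ((u - x) / 2)
  simp only [alphaF, betaF, ← sub_eq_add_neg, show γ - u = -(u - γ) by ring, sub_add_cancel,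
    show y + -(u - γ) = y + γ - u by ring, theta_neg]
  linear_combination (norm := (field_simp; ring)) theta τ γ /
    (theta τ (x - γ) * theta τ (y - γ) * theta τ (x + y - γ) * theta τ (u - γ) ^ 2) * F

theorem weight_identity_reverse (hτ : 0 < τ.im) {x y u v : ℂ} (hx : theta τ (x - γ) ≠ 0)
    (hy : theta τ (y - γ) ≠ 0) (hxy : theta τ (x + y - γ) ≠ 0) (hu : theta τ u ≠ 0)
    (hv : theta τ v ≠ 0) (huv : theta τ (u + v) ≠ 0) :
    alphaF τ γ x u * betaF τ γ (x + y) (u + v) * alphaF τ γ y (-u) +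
        betaF τ γ x u * betaF τ γ (x + y) v * betaF τ γ y u =
      alphaF τ γ y v * betaF τ γ (x + y) (u + v) * alphaF τ γ x (-v) +
        betaF τ γ y v * betaF τ γ (x + y) u * betaF τ γ x v := by
  have F₁ := theta_three_term hτ u γ v 0
  have F₂ : theta τ (x + y + (u + v)) * theta τ x * theta τ y * theta τ (u - v) +
      theta τ (x + u) * theta τ (x + y + v) * theta τ (y + u) * theta τ v -
      theta τ (y + v) * theta τ (x + y + u) * theta τ (x + v) * theta τ u = 0 := by
    linear_combination (norm := ring_nf) theta_three_term hτ
      (x + (y + u + v) / 2) ((y + u + v) / 2) ((y + u - v) / 2) ((y - u + v) / 2)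
  simp only [add_zero, sub_zero, add_comm γ v, show γ - v = -(v - γ) by ring, theta_neg] at F₁
  simp only [alphaF, betaF, show -u + γ = -(u - γ) by ring, show -v + γ = -(v - γ) by ring,
    theta_neg]
  linear_combination (norm := (field_simp; ring))
    -(theta τ γ * theta τ (x + y + (u + v)) * theta τ x * theta τ y) /
      (theta τ (x - γ) * theta τ (y - γ) * theta τ (x + y - γ) *
        (theta τ (u + v) * theta τ u ^ 2 * theta τ v ^ 2)) * F₁ -
    theta τ γ ^ 3 / (theta τ (x - γ) * theta τ (y - γ) * theta τ (x + y - γ) *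
      (theta τ u ^ 2 * theta τ v ^ 2)) * F₂

theorem weight_identity_diagonal (hτ : 0 < τ.im) {x y u : ℂ} (hx : theta τ (x - γ) ≠ 0)
    (hy : theta τ (y - γ) ≠ 0) (hxy : theta τ (x + y - γ) ≠ 0) (hu : theta τ u ≠ 0)
    (hu' : theta τ (u - γ) ≠ 0) :
    alphaF τ γ x (u - γ) * alphaF τ γ y (γ - u) +
        betaF τ γ x (u - γ) * betaF τ γ (x + y) (-u) * betaF τ γ y (u - γ) =
      alphaF τ γ y (-u) * alphaF τ γ x u +
        betaF τ γ y (-u) * betaF τ γ (x + y) (u - γ) * betaF τ γ x (-u) := by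
  have F₁ := theta_three_term hτ (u - γ) γ u 0
  have F₂ : theta τ (x + y - γ) * theta τ x * theta τ y * theta τ (2 * u - γ) -
      theta τ (x + (u - γ)) * theta τ (x + y - u) * theta τ (y + (u - γ)) * theta τ u -
      theta τ (y - u) * theta τ (x + y + (u - γ)) * theta τ (x - u) * theta τ (u - γ) = 0 := by
    rw [← neg_neg (theta τ u), ← theta_neg]
    linear_combination (norm := ring_nf) theta_three_term hτ
      (x + (y - γ) / 2) ((y - γ) / 2) ((y + 2 * u - γ) / 2) ((y - 2 * u + γ) / 2)
  simp only [add_zero, sub_zero, add_comm γ u, sub_add_cancel, sub_sub_cancel_left,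
    show u - γ + u = 2 * u - γ by ring, show γ - u = -(u - γ) by ring, theta_neg] at F₁
  simp only [alphaF, betaF, ← sub_eq_add_neg, show γ - u = -(u - γ) by ring, sub_add_cancel,
    show -(u - γ) + γ = -(u - γ - γ) by ring, show -u + γ = -(u - γ) by ring, theta_neg]
  linear_combination (norm := (field_simp; ring))
    theta τ x * theta τ y /
      (theta τ (x - γ) * theta τ (y - γ) *
        (theta τ u ^ 2 * theta τ (u - γ) ^ 2)) * F₁ -
    theta τ γ ^ 3 / (theta τ (x - γ) * theta τ (y - γ) * theta τ (x + y - γ) *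
      (theta τ u ^ 2 * theta τ (u - γ) ^ 2)) * F₂

end Weights

section DynamicalYangBaxter

variable {ι : Type*} [DecidableEq ι]

/-- `λ - γ ω_k`. -/
def weightShift (γ : ℂ) (l : ι → ℂ) (k : ι) : ι → ℂ := fun m => l m - if k = m then γ else 0

/-- The action of `R(z, l)` on a tensor in `ℂ^ι ⊗ ℂ^ι` given by its coordinates `F`. -/
def dynOp (τ γ z : ℂ) (l : ι → ℂ) (F : ι → ι → ℂ) (i j : ι) : ℂ :=
  if i = j then F i j
  else alphaF τ γ z (l i - l j) * F i j + betaF τ γ z (l i - l j) * F j i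

variable {τ γ : ℂ}

theorem dynOp_neg_dynOp (hτ : 0 < τ.im) {z : ℂ} {l : ι → ℂ} (hz : theta τ (z - γ) ≠ 0)
    (hz' : theta τ (-z - γ) ≠ 0) (hl : ∀ i j, i ≠ j → theta τ (l i - l j) ≠ 0)
    (F : ι → ι → ℂ) (i j : ι) :
    dynOp τ γ (-z) l (fun j i => dynOp τ γ z l F i j) j i = F i j := by
  rcases eq_or_ne i j with rfl | h
  · simp [dynOp]
  · have h₁ := alphaF_neg_mul_add hτ hz hz' (hl i j h)
    have h₂ := alphaF_neg_mul_add_eq_zero hz hz' (hl i j h)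
    simp only [dynOp, if_neg h, if_neg h.symm]
    rw [← neg_sub (l i) (l j)]
    linear_combination F i j * h₁ + F j i * h₂

theorem dynamical_yang_baxter (hτ : 0 < τ.im) {x y : ℂ} {l : ι → ℂ}
    (hx : theta τ (x - γ) ≠ 0) (hy : theta τ (y - γ) ≠ 0) (hxy : theta τ (x + y - γ) ≠ 0)
    (hl : ∀ i j, i ≠ j → theta τ (l i - l j) ≠ 0)
    (hl' : ∀ i j, i ≠ j → theta τ (l i - l j - γ) ≠ 0) (V : ι → ι → ι → ℂ) (i j k : ι) :
    dynOp τ γ x (weightShift γ l k) (fun i j =>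
      dynOp τ γ (x + y) l (fun i k =>
        dynOp τ γ y (weightShift γ l i) (fun j k => V i j k) j k) i k) i j =
    dynOp τ γ y l (fun j k =>
      dynOp τ γ (x + y) (weightShift γ l j) (fun i k =>
        dynOp τ γ x l (fun i j => V i j k) i j) i k) j k := by
  have hyx : theta τ (y + x - γ) ≠ 0 := by rwa [add_comm y x]
  have comm := alphaF_mul_comm τ γ
  rcases eq_or_ne i j with rfl | hij
  · rcases eq_or_ne i k with rfl | hik
    · simp [dynOp]
    have hu := hl i k hik
    have hu' := hl' i k hik
    simp only [dynOp, weightShift, hik, hik.symm, if_true, if_false, sub_zero]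
    rw [← neg_sub (l i) (l k), show l i - γ - l k = l i - l k - γ by ring]
    generalize l i - l k = u at hu hu' ⊢
    linear_combination V i i k * comm (x + y) y u (u - γ) +
      V i k i * weight_identity_left hτ hx hy hxy hu hu' +
      V k i i * weight_identity_swap hτ hx hy hxy hu hu'
  rcases eq_or_ne j k with rfl | hjk
  · have hu := hl i j hij
    have hu' : theta τ (l i - l j + γ) ≠ 0 := by
      rw [show l i - l j + γ = -(l j - l i - γ) by ring, theta_neg]
      exact neg_ne_zero.2 (hl' j i hij.symm)
    simp only [dynOp, weightShift, hij, hij.symm, if_true, if_false, sub_zero]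
    rw [show l j - γ - l i = -(l i - l j + γ) by ring,
      show l i - (l j - γ) = l i - l j + γ by ring]
    generalize l i - l j = u at hu hu' ⊢
    have hu'' : theta τ (u + γ - γ) ≠ 0 := by rwa [add_sub_cancel_right]
    have h₁ := weight_identity_left hτ hy hx hyx hu' hu''
    have h₂ := weight_identity_swap hτ hy hx hyx hu' hu''
    rw [add_sub_cancel_right, add_comm y x] at h₁ h₂
    linear_combination V i j j * comm x (x + y) (u + γ) u - V j i j * h₁ - V j j i * h₂
  rcases eq_or_ne i k with rfl | hik
  · have hu := hl i j hij
    have hu' := hl' i j hij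
    simp only [dynOp, weightShift, hij, hij.symm, if_true, if_false, sub_zero]
    rw [show l j - (l i - γ) = γ - (l i - l j) by ring,
      show l i - γ - l j = l i - l j - γ by ring, ← neg_sub (l i) (l j)]
    generalize l i - l j = u at hu hu' ⊢
    have h := weight_identity_middle hτ hy hx hyx (u := γ - u)
      (by rwa [← neg_sub, theta_neg, neg_ne_zero])
      (by rwa [sub_sub_cancel_left, theta_neg, neg_ne_zero])
    rw [sub_sub_cancel, sub_sub_cancel_left, neg_sub, add_comm y x] at h
    linear_combination V i j i * weight_identity_diagonal hτ hx hy hxy hu hu' +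
      V i i j * weight_identity_middle hτ hx hy hxy hu hu' - V j i i * h
  · have hu := hl i j hij
    have hv := hl j k hjk
    have huv := hl i k hik
    simp only [dynOp, weightShift, hij, hij.symm, hjk, hjk.symm, hik, hik.symm, if_false,
      sub_zero]
    rw [← neg_sub (l i) (l j), ← neg_sub (l j) (l k),
      show l i - l k = l i - l j + (l j - l k) by ring] at *
    generalize l i - l j = u at hu huv ⊢
    generalize l j - l k = v at hv huv ⊢
    have h := weight_identity_distinct hτ hy hx hyx hv hu (by rwa [add_comm v u])
    rw [add_comm y x, add_comm v u] at h
    linear_combination V i k j * betaF τ γ y v * comm x (x + y) u (u + v) +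
      V j i k * betaF τ γ x u * comm (x + y) y v (u + v) +
      V k i j * weight_identity_distinct hτ hx hy hxy hu hv huv +
      V k j i * weight_identity_reverse hτ hx hy hxy hu hv huv - V j k i * h

end DynamicalYangBaxter

section Operators

variable {N n : ℕ} {τ γ : ℂ} {lam : Fin N → ℂ}

theorem shiftL_congr {S : Finset (Fin n)} {f g : Fin n → Fin N} (h : ∀ c ∈ S, f c = g c) :
    shiftL γ lam S f = shiftL γ lam S g := by
  funext i
  simp only [shiftL]
  rw [Finset.filter_congr fun c hc => by rw [h c hc]]

theorem shiftL_insert {S : Finset (Fin n)} {c : Fin n} (hc : c ∉ S) (f : Fin n → Fin N) :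
    shiftL γ lam (insert c S) f = weightShift γ (shiftL γ lam S f) (f c) := by
  funext i
  simp only [shiftL, weightShift, Finset.filter_insert]
  split_ifs with h
  · rw [Finset.card_insert_of_notMem fun h' => hc (Finset.mem_of_mem_filter _ h')]
    push_cast
    ring
  · ring

theorem shiftL_comp_perm {S : Finset (Fin n)} (σ : Equiv.Perm (Fin n))
    (hσ : ∀ c, c ∈ S ↔ σ c ∈ S) (f : Fin n → Fin N) :
    shiftL γ lam S (f ∘ σ) = shiftL γ lam S f := by
  funext i
  simp only [shiftL]
  exact congrArg (fun m : ℕ => lam i - γ * (m : ℂ)) (Finset.card_equiv σ fun c => by simp [hσ c])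

theorem eq_update_update_iff {a b : Fin n} (hab : a ≠ b) (f g : Fin n → Fin N) (i j : Fin N) :
    g = Function.update (Function.update f a i) b j ↔
      (∀ c, c ≠ a → c ≠ b → f c = g c) ∧ (g a, g b) = (i, j) := by
  constructor
  · rintro rfl
    exact ⟨fun c hca hcb => by simp [hca, hcb], by simp [hab]⟩
  · rintro ⟨h, hg⟩
    obtain ⟨rfl, rfl⟩ := Prod.mk.inj hg
    funext c
    by_cases hcb : c = b
    · simp [hcb]
    · by_cases hca : c = a
      · subst hca; simp [hcb]
      · simp [hcb, hca, h c hca hcb]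

theorem Rop_mulVec {z : ℂ} {S : Finset (Fin n)} {a b : Fin n} (hab : a ≠ b) (ha : a ∉ S)
    (hb : b ∉ S) (v : (Fin n → Fin N) → ℂ) (f : Fin n → Fin N) :
    (Rop N n τ γ z lam S a b *ᵥ v) f =
      dynOp τ γ z (shiftL γ lam S f)
        (fun i j => v (Function.update (Function.update f a i) b j)) (f a) (f b) := by
  have entry : ∀ g, Rop N n τ γ z lam S a b f g =
      if f a = f b then if g = Function.update (Function.update f a (f a)) b (f b) then 1 else 0
      else (if g = Function.update (Function.update f a (f a)) b (f b) then
          alphaF τ γ z (shiftL γ lam S f (f a) - shiftL γ lam S f (f b)) else 0) +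
        (if g = Function.update (Function.update f a (f b)) b (f a) then
          betaF τ γ z (shiftL γ lam S f (f a) - shiftL γ lam S f (f b)) else 0) := by
    intro g
    by_cases hg : ∀ c, c ≠ a → c ≠ b → f c = g c
    · have hS : shiftL γ lam S g = shiftL γ lam S f := shiftL_congr fun c hc =>
        (hg c (by rintro rfl; exact ha hc) (by rintro rfl; exact hb hc)).symm
      simp only [eq_update_update_iff hab, Rop, Rmat, if_pos hg, hS, and_iff_right hg]
    · simp only [eq_update_update_iff hab, Rop, hg, false_and, if_false, ite_self, add_zero]
  simp only [mulVec, dotProduct, entry, dynOp]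
  by_cases h : f a = f b
  · simp [h]
  · simp [h, add_mul, Finset.sum_add_distrib]

theorem dynOp_congr {ι : Type*} [DecidableEq ι] {z : ℂ} {l : ι → ℂ} {F G : ι → ι → ℂ} {i j : ι}
    (h : F i j = G i j) (h' : F j i = G j i) : dynOp τ γ z l F i j = dynOp τ γ z l G i j := by
  simp only [dynOp, h, h']

theorem dynOp_comm {ι : Type*} [DecidableEq ι] (z w : ℂ) (l m : ι → ℂ)
    (H : ι → ι → ι → ι → ℂ) (i j p q : ι) :
    dynOp τ γ z l (fun i j => dynOp τ γ w m (fun p q => H i j p q) p q) i j =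
      dynOp τ γ w m (fun p q => dynOp τ γ z l (fun i j => H i j p q) i j) p q := by
  simp only [dynOp]
  split_ifs <;> ring

theorem Rop_neg_mul_Rop (hτ : 0 < τ.im) {z : ℂ} {S : Finset (Fin n)} {a b : Fin n} (hab : a ≠ b)
    (ha : a ∉ S) (hb : b ∉ S) (hz : theta τ (z - γ) ≠ 0) (hz' : theta τ (-z - γ) ≠ 0)
    (hl : ∀ f i j, i ≠ j → theta τ (shiftL γ lam S f i - shiftL γ lam S f j) ≠ 0) :
    Rop N n τ γ (-z) lam S b a * Rop N n τ γ z lam S a b = 1 := by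
  refine Matrix.mulVec_injective (funext fun v => funext fun f => ?_)
  rw [← mulVec_mulVec, one_mulVec, Rop_mulVec hab.symm hb ha]
  have h : ∀ i j, (Rop N n τ γ z lam S a b *ᵥ v)
      (Function.update (Function.update f b j) a i) = dynOp τ γ z (shiftL γ lam S f)
        (fun i j => v (Function.update (Function.update f a i) b j)) i j := by
    intro i j
    rw [Rop_mulVec hab ha hb, shiftL_congr (g := f)]
    · simp [hab.symm, Function.update_comm hab]
    · intro c hc
      have hca : c ≠ a := by rintro rfl; exact ha hc
      have hcb : c ≠ b := by rintro rfl; exact hb hc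
      simp [hca, hcb]
  simp only [h]
  rw [dynOp_neg_dynOp hτ hz hz' (hl f)]
  simp

theorem Rop_mul_comm {z w : ℂ} {S T : Finset (Fin n)} {a b c d : Fin n} (hab : a ≠ b)
    (hcd : c ≠ d) (haS : a ∉ S) (hbS : b ∉ S) (hcS : c ∉ S) (hdS : d ∉ S)
    (haT : a ∈ T) (hbT : b ∈ T) (hcT : c ∉ T) (hdT : d ∉ T) :
    Rop N n τ γ z lam S a b * Rop N n τ γ w lam T c d =
      Rop N n τ γ w lam T c d * Rop N n τ γ z lam S a b := by
  have hac : a ≠ c := by rintro rfl; exact hcT haT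
  have had : a ≠ d := by rintro rfl; exact hdT haT
  have hbc : b ≠ c := by rintro rfl; exact hcT hbT
  have hbd : b ≠ d := by rintro rfl; exact hdT hbT
  refine Matrix.mulVec_injective (funext fun v => funext fun f => ?_)
  simp only [← mulVec_mulVec]
  rw [Rop_mulVec hab haS hbS, Rop_mulVec hcd hcT hdT]
  let H : Fin N → Fin N → Fin N → Fin N → ℂ := fun i j p q => v (Function.update
    (Function.update (Function.update (Function.update f a i) b j) c p) d q)
  have h₁ : ∀ i j, shiftL γ lam T (Function.update (Function.update f a i) b j) =
        shiftL γ lam T f →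
      (Rop N n τ γ w lam T c d *ᵥ v) (Function.update (Function.update f a i) b j) =
        dynOp τ γ w (shiftL γ lam T f) (H i j) (f c) (f d) := by
    intro i j hij
    rw [Rop_mulVec hcd hcT hdT, hij]
    simp [H, hac.symm, had.symm, hbc.symm, hbd.symm]
  have h₂ : ∀ p q, (Rop N n τ γ z lam S a b *ᵥ v)
      (Function.update (Function.update f c p) d q) =
        dynOp τ γ z (shiftL γ lam S f) (fun i j => H i j p q) (f a) (f b) := by
    intro p q
    rw [Rop_mulVec hab haS hbS, shiftL_congr (g := f)]
    · simp only [H, Function.update_comm hac, Function.update_comm had,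
        Function.update_comm hbc, Function.update_comm hbd]
      simp [hac, had, hbc, hbd]
    · intro e he
      have hec : e ≠ c := by rintro rfl; exact hcS he
      have hed : e ≠ d := by rintro rfl; exact hdS he
      simp [hec, hed]
  simp only [h₂]
  rw [← dynOp_comm]
  apply dynOp_congr
  · exact h₁ _ _ (by simp)
  · refine h₁ _ _ ?_
    have hswap : Function.update (Function.update f a (f b)) b (f a) = f ∘ Equiv.swap a b := by
      funext e
      by_cases heb : e = b
      · simp [heb]
      · by_cases hea : e = a
        · subst hea; simp [heb]
        · simp [heb, hea, Equiv.swap_apply_of_ne_of_ne hea heb]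
    rw [hswap, shiftL_comp_perm]
    intro e
    by_cases hea : e = a
    · simp [hea, haT, hbT]
    · by_cases heb : e = b
      · simp [heb, haT, hbT]
      · rw [Equiv.swap_apply_of_ne_of_ne hea heb]

theorem Rop_yang_baxter (hτ : 0 < τ.im) {x y : ℂ} {S : Finset (Fin n)} {a b c : Fin n}
    (hab : a ≠ b) (hac : a ≠ c) (hbc : b ≠ c) (ha : a ∉ S) (hb : b ∉ S) (hc : c ∉ S)
    (hx : theta τ (x - γ) ≠ 0) (hy : theta τ (y - γ) ≠ 0) (hxy : theta τ (x + y - γ) ≠ 0)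
    (hl : ∀ f i j, i ≠ j → theta τ (shiftL γ lam S f i - shiftL γ lam S f j) ≠ 0)
    (hl' : ∀ f i j, i ≠ j → theta τ (shiftL γ lam S f i - shiftL γ lam S f j - γ) ≠ 0) :
    Rop N n τ γ x lam (insert c S) a b * Rop N n τ γ (x + y) lam S a c *
        Rop N n τ γ y lam (insert a S) b c =
      Rop N n τ γ y lam S b c * Rop N n τ γ (x + y) lam (insert b S) a c *
        Rop N n τ γ x lam S a b := by
  refine Matrix.mulVec_injective (funext fun v => funext fun f => ?_)
  simp only [← mulVec_mulVec]
  let G : Fin N → Fin N → Fin N → Fin n → Fin N := fun i j k =>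
    Function.update (Function.update (Function.update f a i) b j) c k
  have hGa : ∀ i j k, G i j k a = i := fun i j k => by simp [G, hab, hac]
  have hGb : ∀ i j k, G i j k b = j := fun i j k => by simp [G, hbc]
  have hGc : ∀ i j k, G i j k c = k := fun i j k => by simp [G]
  have hS : ∀ i j k, shiftL γ lam S (G i j k) = shiftL γ lam S f := by
    refine fun i j k => shiftL_congr fun e he => ?_
    have hea : e ≠ a := by rintro rfl; exact ha he
    have heb : e ≠ b := by rintro rfl; exact hb he
    have hec : e ≠ c := by rintro rfl; exact hc he
    simp [G, hea, heb, hec]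
  have h₁₂ : ∀ (z : ℂ) (T : Finset (Fin n)) (u : (Fin n → Fin N) → ℂ) (i j k : Fin N),
      a ∉ T → b ∉ T → (Rop N n τ γ z lam T a b *ᵥ u) (G i j k) =
        dynOp τ γ z (shiftL γ lam T (G i j k)) (fun i j => u (G i j k)) i j := by
    intro z T u i j k haT hbT
    rw [Rop_mulVec hab haT hbT, hGa, hGb]
    congr! 4 with i' j'
    simp [G, Function.update_comm hac, Function.update_comm hbc, Function.update_comm hab]
  have h₁₃ : ∀ (z : ℂ) (T : Finset (Fin n)) (u : (Fin n → Fin N) → ℂ) (i j k : Fin N),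
      a ∉ T → c ∉ T → (Rop N n τ γ z lam T a c *ᵥ u) (G i j k) =
        dynOp τ γ z (shiftL γ lam T (G i j k)) (fun i k => u (G i j k)) i k := by
    intro z T u i j k haT hcT
    rw [Rop_mulVec hac haT hcT, hGa, hGc]
    congr! 4 with i' k'
    simp [G, Function.update_comm hac, Function.update_comm hab]
  have h₂₃ : ∀ (z : ℂ) (T : Finset (Fin n)) (u : (Fin n → Fin N) → ℂ) (i j k : Fin N),
      b ∉ T → c ∉ T → (Rop N n τ γ z lam T b c *ᵥ u) (G i j k) =
        dynOp τ γ z (shiftL γ lam T (G i j k)) (fun j k => u (G i j k)) j k := by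
    intro z T u i j k hbT hcT
    rw [Rop_mulVec hbc hbT hcT, hGb, hGc]
    congr! 4 with j' k'
    simp [G, Function.update_comm hbc]
  have hf : f = G (f a) (f b) (f c) := by simp [G]
  have hcS : ∀ e, e ≠ c → e ∉ S → e ∉ insert c S := fun e => by simp +contextual
  have haS : ∀ e, e ≠ a → e ∉ S → e ∉ insert a S := fun e => by simp +contextual
  have hbS : ∀ e, e ≠ b → e ∉ S → e ∉ insert b S := fun e => by simp +contextual
  rw [hf, h₁₂ _ _ _ _ _ _ (hcS a hac ha) (hcS b hbc hb), h₂₃ _ _ _ _ _ _ hb hc]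
  simp only [h₁₃ _ _ _ _ _ _ ha hc, h₁₂ _ _ _ _ _ _ ha hb,
    h₂₃ _ _ _ _ _ _ (haS b hab.symm hb) (haS c hac.symm hc),
    h₁₃ _ _ _ _ _ _ (hbS a hab ha) (hbS c hbc.symm hc),
    shiftL_insert ha, shiftL_insert hb, shiftL_insert hc, hS, hGa, hGb, hGc]
  exact dynamical_yang_baxter hτ hx hy hxy (hl f) (hl' f) (fun i j k => v (G i j k)) _ _ _

end Operators

section Words

variable {N n : ℕ} {τ γ : ℂ} {z : Fin (n + 1) → ℂ} {lam : Fin N → ℂ}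

/-- The tensor factors standing at the positions below `i` in the ordering `π`. -/
def factorsBelow (π : Equiv.Perm (Fin (n + 1))) (i : ℕ) : Finset (Fin (n + 1)) :=
  (Finset.univ.filter fun c : Fin (n + 1) => (c : ℕ) < i).image π

theorem apply_mem_factorsBelow (π : Equiv.Perm (Fin (n + 1))) (i : ℕ) (c : Fin (n + 1)) :
    π c ∈ factorsBelow π i ↔ (c : ℕ) < i := by
  simp [factorsBelow]

theorem factorsBelow_mul (π σ : Equiv.Perm (Fin (n + 1))) {i : ℕ}
    (hσ : ∀ c, ((σ c : Fin (n + 1)) : ℕ) < i ↔ (c : ℕ) < i) :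
    factorsBelow (π * σ) i = factorsBelow π i := by
  ext d
  obtain ⟨c, rfl⟩ := (π * σ).surjective d
  rw [apply_mem_factorsBelow, Equiv.Perm.mul_apply, apply_mem_factorsBelow, hσ]

theorem factorsBelow_succ (π : Equiv.Perm (Fin (n + 1))) (c : Fin (n + 1)) :
    factorsBelow π (c + 1) = insert (π c) (factorsBelow π c) := by
  ext d
  obtain ⟨e, rfl⟩ := π.surjective d
  rw [Finset.mem_insert, apply_mem_factorsBelow, apply_mem_factorsBelow, π.injective.eq_iff,
    Fin.ext_iff]
  omega

theorem swap_val_lt_iff (a : Fin n) {i : ℕ} (hi : i ≠ a + 1) (c : Fin (n + 1)) :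
    ((Equiv.swap a.castSucc a.succ c : Fin (n + 1)) : ℕ) < i ↔ (c : ℕ) < i := by
  rcases eq_or_ne c a.castSucc with rfl | h
  · simp only [Equiv.swap_apply_left, Fin.val_succ, Fin.val_castSucc]
    omega
  rcases eq_or_ne c a.succ with rfl | h'
  · simp only [Equiv.swap_apply_right, Fin.val_succ, Fin.val_castSucc]
    omega
  · rw [Equiv.swap_apply_of_ne_of_ne h h']

/-- The effect of a letter on a pair formed by the current ordering of the tensor factors and the
product of R-matrices accumulated so far. -/
def letterStep (τ γ : ℂ) (z : Fin (n + 1) → ℂ) (lam : Fin N → ℂ) (a : Fin n) :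
    Function.End (Equiv.Perm (Fin (n + 1)) ×
      Matrix (Fin (n + 1) → Fin N) (Fin (n + 1) → Fin N) ℂ) := fun p =>
  (p.1 * Equiv.swap a.castSucc a.succ,
    Rop N (n + 1) τ γ (z (p.1 a.castSucc) - z (p.1 a.succ)) lam (factorsBelow p.1 a)
      (p.1 a.castSucc) (p.1 a.succ) * p.2)

/-- `letterStep` in the opposite monoid, where products list the letters in order of application,
extended by `1` to all natural numbers. -/
def letterOp (τ γ : ℂ) (z : Fin (n + 1) → ℂ) (lam : Fin N → ℂ) (i : ℕ) :
    (Function.End (Equiv.Perm (Fin (n + 1)) ×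
      Matrix (Fin (n + 1) → Fin N) (Fin (n + 1) → Fin N) ℂ))ᵐᵒᵖ :=
  if h : i < n then MulOpposite.op (letterStep τ γ z lam ⟨i, h⟩) else 1

theorem letterOp_val (a : Fin n) :
    letterOp τ γ z lam a = MulOpposite.op (letterStep τ γ z lam a) := by
  simp [letterOp]

theorem unop_prod_letterOp (w : List (Fin n)) (π : Equiv.Perm (Fin (n + 1)))
    (A : Matrix (Fin (n + 1) → Fin N) (Fin (n + 1) → Fin N) ℂ) :
    ((w.map Fin.val).map (letterOp τ γ z lam)).prod.unop (π, A) =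
      (π * permOfWord w, Wword N τ γ z lam w π * A) := by
  induction w generalizing π A with
  | nil =>
    rw [permOfWord, Wword, mul_one, Matrix.one_mul]
    rfl
  | cons a w ih =>
    rw [List.map_cons, List.map_cons, List.prod_cons, letterOp_val, MulOpposite.unop_mul,
      MulOpposite.unop_op]
    refine (ih _ _).trans ?_
    rw [permOfWord, Wword, mul_assoc, Matrix.mul_assoc]
    rfl

theorem prod_adjSwap_apply (w : List (Fin n)) (i : Fin (n + 1)) :
    ((w.map Fin.val).map adjSwap).prod i = permOfWord w i := by
  induction w generalizing i with
  | nil => simp [permOfWord]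
  | cons a w ih =>
    simp only [List.map_cons, List.prod_cons, Equiv.Perm.mul_apply, permOfWord, ih]
    rw [adjSwap, ← Fin.val_succ, ← Fin.val_castSucc]
    exact (Fin.val_injective.map_swap _ _ _).symm

theorem prod_adjSwap_eq {w w' : List (Fin n)} (h : permOfWord w = permOfWord w') :
    ((w.map Fin.val).map adjSwap).prod = ((w'.map Fin.val).map adjSwap).prod := by
  have hlt : ∀ u : List (Fin n), ∀ a ∈ u.map Fin.val, a < n := by simp
  ext m
  rcases lt_or_ge n m with hm | hm
  · rw [prod_adjSwap_apply_of_lt hm _ (hlt w), prod_adjSwap_apply_of_lt hm _ (hlt w')]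
  · have h₁ := prod_adjSwap_apply w ⟨m, Nat.lt_succ_of_le hm⟩
    have h₂ := prod_adjSwap_apply w' ⟨m, Nat.lt_succ_of_le hm⟩
    rw [← h] at h₂
    exact h₁.trans h₂.symm

/-- The parameters at which the relations between R-matrices on `n + 1` factors are used. -/
structure IsGeneric (τ γ : ℂ) (z : Fin (n + 1) → ℂ) (lam : Fin N → ℂ) : Prop where
  theta_sub_ne_zero : ∀ p q, p ≠ q → theta τ (z p - z q - γ) ≠ 0
  theta_shift_ne_zero : ∀ i j, i ≠ j → ∀ m ∈ Finset.Icc (-(n + 2) : ℤ) (n + 2),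
    theta τ (lam i - lam j + m * γ) ≠ 0

theorem IsGeneric.theta_shiftL_ne_zero (h : IsGeneric τ γ z lam) (S : Finset (Fin (n + 1)))
    (f : Fin (n + 1) → Fin N) (i j : Fin N) (hij : i ≠ j) (e : ℕ) (he : e ≤ 1) :
    theta τ (shiftL γ lam S f i - shiftL γ lam S f j - e * γ) ≠ 0 := by
  have hle : ∀ k, (S.filter fun c => f c = k).card ≤ n + 1 := fun k =>
    (Finset.card_le_univ _).trans_eq (Fintype.card_fin _)
  have hi := hle i
  have hj := hle j
  have := h.theta_shift_ne_zero i j hij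
    ((S.filter fun c => f c = j).card - (S.filter fun c => f c = i).card - e)
    (Finset.mem_Icc.2 (by omega))
  convert this using 2
  simp only [shiftL]
  push_cast
  ring

theorem letterStep_sq (hτ : 0 < τ.im) (h : IsGeneric τ γ z lam) (a : Fin n) :
    letterStep τ γ z lam a * letterStep τ γ z lam a = 1 := by
  funext ⟨π, A⟩
  have hab : a.castSucc ≠ a.succ := (Fin.castSucc_lt_succ).ne
  have key := Rop_neg_mul_Rop (lam := lam) hτ (S := factorsBelow π a) (π.injective.ne hab)
    (by simp [apply_mem_factorsBelow]) (by simp [apply_mem_factorsBelow])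
    (h.theta_sub_ne_zero _ _ (π.injective.ne hab))
    (by rw [neg_sub]; exact h.theta_sub_ne_zero _ _ (π.injective.ne hab.symm))
    (fun f i j hij => by simpa using h.theta_shiftL_ne_zero _ f i j hij 0 zero_le_one)
  change letterStep τ γ z lam a (letterStep τ γ z lam a (π, A)) = (π, A)
  simp only [letterStep]
  rw [factorsBelow_mul _ _ (swap_val_lt_iff a (by omega))]
  simp only [Equiv.Perm.mul_apply, Equiv.swap_apply_left, Equiv.swap_apply_right, mul_assoc,
    Equiv.swap_mul_self, mul_one]
  rw [← Matrix.mul_assoc, ← neg_sub, key, Matrix.one_mul]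

theorem letterStep_comm {a b : Fin n} (hab : (a : ℕ) + 1 < b) :
    letterStep τ γ z lam a * letterStep τ γ z lam b =
      letterStep τ γ z lam b * letterStep τ γ z lam a := by
  funext ⟨π, A⟩
  have ne : ∀ c d : Fin (n + 1), (c : ℕ) ≠ d → c ≠ d := fun c d h => by rintro rfl; exact h rfl
  have h₁ : a.castSucc ≠ b.castSucc := ne _ _ (by simp; omega)
  have h₂ : a.castSucc ≠ b.succ := ne _ _ (by simp; omega)
  have h₃ : a.succ ≠ b.castSucc := ne _ _ (by simp; omega)
  have h₄ : a.succ ≠ b.succ := ne _ _ (by simp; omega)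
  have key := Rop_mul_comm (τ := τ) (γ := γ) (lam := lam)
    (z := z (π a.castSucc) - z (π a.succ)) (w := z (π b.castSucc) - z (π b.succ))
    (S := factorsBelow π a) (T := factorsBelow π b)
    (π.injective.ne (Fin.castSucc_lt_succ (i := a)).ne)
    (π.injective.ne (Fin.castSucc_lt_succ (i := b)).ne)
    (by simp [apply_mem_factorsBelow]) (by simp [apply_mem_factorsBelow])
    (by simp [apply_mem_factorsBelow]; omega) (by simp [apply_mem_factorsBelow]; omega)
    (by simp [apply_mem_factorsBelow]; omega) (by simp [apply_mem_factorsBelow]; omega)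
    (by simp [apply_mem_factorsBelow]) (by simp [apply_mem_factorsBelow])
  change letterStep τ γ z lam a (letterStep τ γ z lam b (π, A)) =
    letterStep τ γ z lam b (letterStep τ γ z lam a (π, A))
  simp only [letterStep]
  rw [factorsBelow_mul _ _ (swap_val_lt_iff b (by omega)),
    factorsBelow_mul _ _ (swap_val_lt_iff a (by omega))]
  simp only [Equiv.Perm.mul_apply, Equiv.swap_apply_of_ne_of_ne h₁ h₂,
    Equiv.swap_apply_of_ne_of_ne h₃ h₄, Equiv.swap_apply_of_ne_of_ne h₁.symm h₃.symm,
    Equiv.swap_apply_of_ne_of_ne h₂.symm h₄.symm]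
  rw [← Matrix.mul_assoc, ← Matrix.mul_assoc, key, mul_assoc, mul_assoc,
    (Equiv.Perm.disjoint_swap_swap
      (by simp [Fin.ext_iff]; omega)).commute.eq, ← mul_assoc π]

theorem letterStep_braid (hτ : 0 < τ.im) (h : IsGeneric τ γ z lam) {a b : Fin n}
    (hab : (b : ℕ) = a + 1) :
    letterStep τ γ z lam a * letterStep τ γ z lam b * letterStep τ γ z lam a =
      letterStep τ γ z lam b * letterStep τ γ z lam a * letterStep τ γ z lam b := by
  funext ⟨π, A⟩
  have ne : ∀ c d : Fin (n + 1), (c : ℕ) ≠ d → c ≠ d := fun c d h => by rintro rfl; exact h rfl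
  have hq : b.castSucc = a.succ := Fin.ext (by simp [hab])
  have hpq : a.castSucc ≠ a.succ := (Fin.castSucc_lt_succ).ne
  have hpr : a.castSucc ≠ b.succ := ne _ _ (by simp; omega)
  have hqr : a.succ ≠ b.succ := ne _ _ (by simp; omega)
  have key := Rop_yang_baxter (lam := lam) hτ (S := factorsBelow π a)
    (x := z (π a.castSucc) - z (π a.succ)) (y := z (π a.succ) - z (π b.succ))
    (π.injective.ne hpq) (π.injective.ne hpr) (π.injective.ne hqr)
    (by simp [apply_mem_factorsBelow]) (by simp [apply_mem_factorsBelow])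
    (by simp [apply_mem_factorsBelow]; omega)
    (h.theta_sub_ne_zero _ _ (π.injective.ne hpq)) (h.theta_sub_ne_zero _ _ (π.injective.ne hqr))
    (by rw [sub_add_sub_cancel]; exact h.theta_sub_ne_zero _ _ (π.injective.ne hpr))
    (fun f i j hij => by simpa using h.theta_shiftL_ne_zero _ f i j hij 0 zero_le_one)
    (fun f i j hij => by simpa using h.theta_shiftL_ne_zero _ f i j hij 1 le_rfl)
  change letterStep τ γ z lam a (letterStep τ γ z lam b (letterStep τ γ z lam a (π, A))) =
    letterStep τ γ z lam b (letterStep τ γ z lam a (letterStep τ γ z lam b (π, A)))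
  have hS : ∀ σ : Equiv.Perm (Fin (n + 1)), factorsBelow σ b =
      insert (σ a.castSucc) (factorsBelow σ a) := fun σ => by
    rw [hab, ← Fin.val_castSucc a, factorsBelow_succ]
  simp only [letterStep, hS]
  have ha := fun π => factorsBelow_mul (n := n) π _ (swap_val_lt_iff a (i := a) (by omega))
  have hb := fun π => factorsBelow_mul (n := n) π _ (swap_val_lt_iff b (i := a) (by omega))
  simp only [ha, hb]
  simp only [hq, Equiv.Perm.mul_apply, Equiv.swap_apply_left, Equiv.swap_apply_right,
    Equiv.swap_apply_of_ne_of_ne hpq hpr, Equiv.swap_apply_of_ne_of_ne hpr.symm hqr.symm]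
  rw [sub_add_sub_cancel] at key
  simp only [← Matrix.mul_assoc]
  rw [key]
  simp only [mul_assoc π]
  rw [swap_braid hpq hpr hqr]

theorem isCoxeterA_letterOp (hτ : 0 < τ.im) (h : IsGeneric τ γ z lam) :
    IsCoxeterA (letterOp τ γ z lam) n where
  sq i hi := by
    simp only [letterOp, dif_pos hi, ← MulOpposite.op_mul, letterStep_sq hτ h, MulOpposite.op_one]
  braid i hi := by
    simp only [letterOp, dif_pos hi, dif_pos (Nat.lt_of_succ_lt hi), ← MulOpposite.op_mul]
    rw [← mul_assoc, ← mul_assoc, letterStep_braid hτ h rfl]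
  comm i j hij hj := by
    simp only [letterOp, dif_pos hj, dif_pos (Nat.lt_of_succ_lt (hij.trans hj)),
      ← MulOpposite.op_mul]
    exact congrArg _ (letterStep_comm hij).symm

theorem Wword_eq_of_isGeneric (hτ : 0 < τ.im) (h : IsGeneric τ γ z lam) {w w' : List (Fin n)}
    (hw : permOfWord w = permOfWord w') :
    Wword N τ γ z lam w 1 = Wword N τ γ z lam w' 1 := by
  have key := (isCoxeterA_letterOp hτ h).prod_eq_prod (w := w.map Fin.val) (w' := w'.map Fin.val)
    (by simp) (by simp) (prod_adjSwap_eq hw)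
  have := congrArg (fun t => (t.unop (1, 1)).2) key
  simpa only [unop_prod_letterOp, Matrix.mul_one] using this

end Words

section Genericity

variable {N n : ℕ} {τ : ℂ}

theorem isOpen_dense_theta_comp {E ι : Type*} [NormedAddCommGroup E] [NormedSpace ℂ E]
    [FiniteDimensional ℂ E] [Finite ι] (hτ : 0 < τ.im) (L : ι → E →ₗ[ℂ] ℂ)
    (hL : ∀ k, L k ≠ 0) :
    IsOpen {p | ∀ k, theta τ (L k p) ≠ 0} ∧ Dense {p | ∀ k, theta τ (L k p) ≠ 0} := by
  have hopen : ∀ k, IsOpen {p | theta τ (L k p) ≠ 0} := fun k =>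
    (isOpen_theta_ne_zero hτ).preimage (L k).continuous_of_finiteDimensional
  have : CompleteSpace E := FiniteDimensional.complete ℂ E
  simp only [Set.ofPred_forall]
  refine ⟨isOpen_iInter_of_finite hopen, dense_iInter_of_isOpen hopen fun k => ?_⟩
  exact (dense_theta_ne_zero hτ).preimage
    ((LinearMap.toContinuousLinearMap (L k)).isOpenMap (LinearMap.surjective (hL k)))

theorem isOpen_dense_isGeneric (N n : ℕ) (hτ : 0 < τ.im) :
    IsOpen {p : (Fin (n + 1) → ℂ) × (Fin N → ℂ) × ℂ | IsGeneric τ p.2.2 p.1 p.2.1} ∧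
      Dense {p : (Fin (n + 1) → ℂ) × (Fin N → ℂ) × ℂ | IsGeneric τ p.2.2 p.1 p.2.1} := by
  let zL (p : Fin (n + 1)) : ((Fin (n + 1) → ℂ) × (Fin N → ℂ) × ℂ) →ₗ[ℂ] ℂ := LinearMap.proj p ∘ₗ LinearMap.fst ℂ _ _
  let lamL (i : Fin N) : ((Fin (n + 1) → ℂ) × (Fin N → ℂ) × ℂ) →ₗ[ℂ] ℂ :=
    LinearMap.proj i ∘ₗ LinearMap.fst ℂ _ _ ∘ₗ LinearMap.snd ℂ _ _
  let γL : ((Fin (n + 1) → ℂ) × (Fin N → ℂ) × ℂ) →ₗ[ℂ] ℂ := LinearMap.snd ℂ _ _ ∘ₗ LinearMap.snd ℂ _ _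
  let L : {q : Fin (n + 1) × Fin (n + 1) // q.1 ≠ q.2} ⊕
      {q : Fin N × Fin N // q.1 ≠ q.2} × Finset.Icc (-(n + 2) : ℤ) (n + 2) →
        ((Fin (n + 1) → ℂ) × (Fin N → ℂ) × ℂ) →ₗ[ℂ] ℂ :=
    Sum.elim (fun q => zL q.1.1 - zL q.1.2 - γL)
      (fun q => lamL q.1.1.1 - lamL q.1.1.2 + ((q.2 : ℤ) : ℂ) • γL)
  have hL : ∀ k, L k ≠ 0 := by
    rintro (⟨⟨p, q⟩, hpq⟩ | ⟨⟨⟨i, j⟩, hij⟩, m⟩) h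
    · have := LinearMap.congr_fun h (Pi.single p 1, 0, 0)
      simp [L, zL, γL, Ne.symm hpq] at this
    · have := LinearMap.congr_fun h (0, Pi.single i 1, 0)
      simp [L, lamL, γL, Ne.symm hij] at this
  have hset : {p : (Fin (n + 1) → ℂ) × (Fin N → ℂ) × ℂ | IsGeneric τ p.2.2 p.1 p.2.1} =
      {p | ∀ k, theta τ (L k p) ≠ 0} := by
    ext p
    refine ⟨?_, fun h => ⟨fun i j hij => h (Sum.inl ⟨(i, j), hij⟩),
      fun i j hij m hm => h (Sum.inr (⟨(i, j), hij⟩, ⟨m, hm⟩))⟩⟩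
    rintro ⟨h₁, h₂⟩ (⟨⟨i, j⟩, hij⟩ | ⟨⟨⟨i, j⟩, hij⟩, m, hm⟩)
    · exact h₁ i j hij
    · exact h₂ i j hij m hm
  rw [hset]
  exact isOpen_dense_theta_comp hτ L hL

end Genericity

/-- two words in the generators of `S_{n+1}` inducing the same permutation
give the same product of dynamical R-matrices (for generic parameters). -/
theorem word_independence (N : ℕ) (hN : 2 ≤ N) (τ : ℂ) (hτ : 0 < τ.im) (n : ℕ)
    (hn : 1 ≤ n) (w w' : List (Fin n)) (hperm : permOfWord w = permOfWord w') :
    ∃ U : Set ((Fin (n + 1) → ℂ) × (Fin N → ℂ) × ℂ), IsOpen U ∧ Dense U ∧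
      ∀ z : Fin (n + 1) → ℂ, ∀ lam : Fin N → ℂ, ∀ γ : ℂ, (z, lam, γ) ∈ U →
        Wword N τ γ z lam w 1 = Wword N τ γ z lam w' 1 := by
  obtain ⟨hopen, hdense⟩ := isOpen_dense_isGeneric (τ := τ) N n hτ
  exact ⟨_, hopen, hdense, fun z lam γ h => Wword_eq_of_isGeneric hτ h hperm⟩

end EllipticQG
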